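/- Let X be a finite uniform d-dimensional simplicial complex with d ≥ 2, and let p satisfy 1/2 ≤ p < 1. Then for every oriented (d−1)-cell σ and every n ≥ 0, the normalized expectation process of the p-lazy (d−1)-walk satisfies dist(Ẽ_n^σ, B^{d−1}) ≤ (1 − ((1−p)/(p(d−1)+1))·λ(X))^n and dist(Ẽ_n^σ, Z^{d−1}) ≤ (1 − ((1−p)/(p(d−1)+1))·λ̃(X))^n, where dist denotes the distance with respect to the norm induced by the inner product on Ω^{d−1}. -/

import Mathlib

open scoped BigOperators Classical
open Filter Topology

noncomputable section

/-- A simplicial complex on a vertex set `V`: a family of finite subsets of `V`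
(the cells) closed under taking nonempty subsets. -/
structure SComplex (V : Type*) where
  cells : Set (Finset V)
  down_closed : ∀ ⦃s t : Finset V⦄, s ∈ cells → t ⊆ s → t.Nonempty → t ∈ cells

namespace SComplex

variable {V : Type*} (X : SComplex V)

/-- The tuple `σ` of `n` vertices spans an `(n-1)`-dimensional cell of `X`. -/
def IsCellT {n : ℕ} (σ : Fin n → V) : Prop :=
  Function.Injective σ ∧ Finset.image σ Finset.univ ∈ X.cells

/-- The degree of a cell `s`: the number of cells with one more vertex containing it. -/
def degS (s : Finset V) : ℕ :=
  Set.ncard {t : Finset V | t ∈ X.cells ∧ t.card = s.card + 1 ∧ s ⊆ t}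

/-- Degree of the cell spanned by a tuple. -/
def degT {n : ℕ} (σ : Fin n → V) : ℕ :=
  X.degS (Finset.image σ Finset.univ)

/-- An `(n-1)`-form: an alternating function on oriented `(n-1)`-cells, encoded as a
function on `n`-tuples of vertices which vanishes off the cells of `X` and is
antisymmetric under permutations. -/
def IsForm (n : ℕ) (f : (Fin n → V) → ℝ) : Prop :=
  (∀ σ, ¬ X.IsCellT σ → f σ = 0) ∧
  ∀ (σ : Fin n → V) (π : Equiv.Perm (Fin n)),
    f (σ ∘ π) = ((Equiv.Perm.sign π : ℤ) : ℝ) * f σ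

/-- The Dirac form `𝟙_{σ₀}`: 1 at `σ₀`, -1 at the reversed orientation, 0 elsewhere. -/
def dirac {n : ℕ} (σ₀ : Fin n → V) : (Fin n → V) → ℝ := fun σ =>
  if ∃ π : Equiv.Perm (Fin n), Equiv.Perm.sign π = 1 ∧ σ = σ₀ ∘ π then 1
  else if ∃ π : Equiv.Perm (Fin n), Equiv.Perm.sign π = -1 ∧ σ = σ₀ ∘ π then -1
  else 0

/-- The boundary operator: `(∂f)(σ) = Σ_{v : vσ ∈ X} f(vσ)`. -/
def bdry {n : ℕ} (f : (Fin (n + 1) → V) → ℝ) : (Fin n → V) → ℝ := fun σ =>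
  ∑ᶠ v ∈ {v : V | X.IsCellT (Fin.cons v σ)}, f (Fin.cons v σ)

/-- The weighted sum of `f` over the neighbours of `σ`:
`Σ_{σ' ∼ σ} f(σ')/deg σ' = Σ_{v ◁ σ} Σ_i (-1)^i f(v(σ∖σ_i))/deg(v(σ∖σ_i))`. -/
def nbrW {n : ℕ} (f : (Fin (n + 1) → V) → ℝ) : (Fin (n + 1) → V) → ℝ := fun σ =>
  ∑ᶠ v ∈ {v : V | X.IsCellT (Fin.cons v σ)},
    ∑ i : Fin (n + 1),
      (-1 : ℝ) ^ (i : ℕ) * f (Fin.cons v (σ ∘ i.succAbove)) /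
        (X.degT (Fin.cons v (σ ∘ i.succAbove)) : ℝ)

/-- The unweighted sum of `f` over the neighbours of `σ`: `Σ_{σ' ∼ σ} f(σ')`. -/
def nbrU {n : ℕ} (f : (Fin (n + 1) → V) → ℝ) : (Fin (n + 1) → V) → ℝ := fun σ =>
  ∑ᶠ v ∈ {v : V | X.IsCellT (Fin.cons v σ)},
    ∑ i : Fin (n + 1), (-1 : ℝ) ^ (i : ℕ) * f (Fin.cons v (σ ∘ i.succAbove))

/-- The upper Laplacian `(Δ⁺f)(σ) = f(σ) - Σ_{σ'∼σ} f(σ')/deg σ'`. -/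
def lapUp {n : ℕ} (f : (Fin (n + 1) → V) → ℝ) : (Fin (n + 1) → V) → ℝ := fun σ =>
  f σ - X.nbrW f σ

/-- The transition operator of the `p`-lazy walk:
`(Af)(σ) = p f(σ) + ((1-p)/d) Σ_{σ'∼σ} f(σ')/deg σ'`, where `d = n+1`. -/
def transOp {n : ℕ} (p : ℝ) (f : (Fin (n + 1) → V) → ℝ) : (Fin (n + 1) → V) → ℝ := fun σ =>
  p * f σ + ((1 - p) / ((n : ℝ) + 1)) * X.nbrW f σ

/-- The normalized expectation process `Ẽ_nn = (d/(p(d-1)+1))^nn • A^nn 𝟙_{σ₀}`. -/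
def nexp {n : ℕ} (p : ℝ) (σ₀ : Fin (n + 1) → V) (nn : ℕ) : (Fin (n + 1) → V) → ℝ :=
  (((n : ℝ) + 1) / (p * (n : ℝ) + 1)) ^ nn • (X.transOp p)^[nn] (SComplex.dirac σ₀)

/-- The weighted inner product `⟨f,g⟩ = Σ_{σ ∈ X^{n-1}} f(σ)g(σ)/deg σ`
(each unoriented cell is represented by `n!` tuples). -/
def innerW [Fintype V] {n : ℕ} (f g : (Fin n → V) → ℝ) : ℝ :=
  (1 / (n.factorial : ℝ)) * ∑ σ : Fin n → V, f σ * g σ / (X.degT σ : ℝ)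

/-- The unweighted inner product `⟨f,g⟩ = Σ_{σ ∈ X^{n-1}} f(σ)g(σ)`. -/
def innerU [Fintype V] {n : ℕ} (f g : (Fin n → V) → ℝ) : ℝ :=
  (1 / (n.factorial : ℝ)) * ∑ σ : Fin n → V, f σ * g σ

/-- The norm induced by the weighted inner product. -/
def normW [Fintype V] {n : ℕ} (f : (Fin n → V) → ℝ) : ℝ :=
  Real.sqrt (X.innerW f f)

/-- `f` is a closed `(d-1)`-form (`f ∈ Z^{d-1} = ker ∂_d^*`), characterized by
orthogonality to the image of `∂_d`. -/
def IsClosedForm [Fintype V] (m : ℕ) (f : (Fin (m + 2) → V) → ℝ) : Prop :=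
  X.IsForm (m + 2) f ∧
  ∀ g : (Fin (m + 3) → V) → ℝ, X.IsForm (m + 3) g → X.innerW f (X.bdry g) = 0

/-- `f` is an exact `(d-1)`-form (`f ∈ B^{d-1} = im ∂_{d-1}^*`): `f = ∂_{d-1}^* g` for a
`(d-2)`-form `g`, characterized by the adjoint identity. -/
def IsExactForm [Fintype V] (m : ℕ) (f : (Fin (m + 2) → V) → ℝ) : Prop :=
  X.IsForm (m + 2) f ∧
  ∃ g : (Fin (m + 1) → V) → ℝ, X.IsForm (m + 1) g ∧
    ∀ h : (Fin (m + 2) → V) → ℝ, X.IsForm (m + 2) h →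
      X.innerW f h = innerU g (X.bdry h)

/-- Two tuples span the same oriented cell. -/
def SameOr {n : ℕ} (σ σ' : Fin n → V) : Prop :=
  ∃ π : Equiv.Perm (Fin n), Equiv.Perm.sign π = 1 ∧ σ' = σ ∘ π

/-- The neighbour relation on oriented `(d-1)`-cells: `σ ∼ σ'` iff there is an oriented
`d`-cell of which both `σ` and the reversal of `σ'` are faces with the induced
orientation; equivalently `σ' = (-1)^i v(σ∖σ_i)` for some `v ◁ σ`. -/
def Nbr {n : ℕ} (σ σ' : Fin (n + 1) → V) : Prop :=
  ∃ (v : V) (i : Fin (n + 1)), X.IsCellT (Fin.cons v σ) ∧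
    (if Even (i : ℕ) then SameOr σ' (Fin.cons v (σ ∘ i.succAbove))
     else SameOr σ' (Fin.cons v (σ ∘ i.succAbove) ∘ Equiv.swap 0 1))

/-- `σ` is a face of the oriented cell `τ` with the orientation induced by `τ`. -/
def IsInducedFace {n : ℕ} (σ : Fin (n + 1) → V) (τ : Fin (n + 2) → V) : Prop :=
  ∃ i : Fin (n + 2), if Even (i : ℕ) then SameOr σ (τ ∘ i.succAbove)
    else SameOr σ (τ ∘ i.succAbove ∘ Equiv.swap 0 1)

/-- The family `𝒯` of `d`-cells (`d = m+2`) admits a disorientation: a choice of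
orientation for each cell of `𝒯` such that any two of them sharing a
codimension-one face induce the same orientation on it. -/
def HasDisorientation (m : ℕ) (𝒯 : Set (Finset V)) : Prop :=
  ∃ c : Finset V → (Fin (m + 3) → V),
    (∀ t ∈ 𝒯, Function.Injective (c t) ∧ Finset.image (c t) Finset.univ = t) ∧
    ∀ t ∈ 𝒯, ∀ t' ∈ 𝒯, t ≠ t' → (t ∩ t').card = m + 2 →
      ∃ σ : Fin (m + 2) → V, Function.Injective σ ∧
        Finset.image σ Finset.univ = t ∩ t' ∧
        IsInducedFace σ (c t) ∧ IsInducedFace σ (c t')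

/-- `X` (of dimension `d`) has no simple `d`-loops: no non-backtracking closed chain
of `d`-cells in which consecutive cells share a `(d-1)`-cell. -/
def NoSimpleLoops (d : ℕ) : Prop :=
  ∀ (n : ℕ) (τ : ℕ → Finset V), 2 ≤ n → (∀ i, τ (i + n) = τ i) →
    (∀ i, τ i ∈ X.cells ∧ (τ i).card = d + 1) →
    (∀ i, (τ i ∩ τ (i + 1)) ∈ X.cells ∧ (τ i ∩ τ (i + 1)).card = d) →
    (∀ i, τ i ≠ τ (i + 2)) → False

end SComplex

namespace SComplex

/-- If a symmetric operator has its eigenvalues in `[l, 1/c]`, then `1 - cT` contracts by `1 - cl`. -/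
theorem norm_sub_smul_le_of_eigenvalues {E : Type*} [NormedAddCommGroup E]
    [InnerProductSpace ℝ E] [FiniteDimensional ℝ E] {T : E →ₗ[ℝ] E} (hT : T.IsSymmetric)
    {c l : ℝ} (hc : 0 ≤ c) (hl : ∀ μ : ℝ, Module.End.HasEigenvalue T μ → l ≤ μ)
    (hu : ∀ μ : ℝ, Module.End.HasEigenvalue T μ → c * μ ≤ 1) (x : E) :
    ‖x - c • T x‖ ≤ (1 - c * l) * ‖x‖ := by
  rcases eq_or_ne x 0 with rfl | hx
  · simp
  have : Nontrivial E := ⟨x, 0, hx⟩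
  have hev : ∀ i, Module.End.HasEigenvalue T (hT.eigenvalues rfl i) := fun i => by
    simpa using hT.hasEigenvalue_eigenvalues rfl i
  have hlow : ∀ i, 0 ≤ 1 - c * hT.eigenvalues rfl i := fun i => by linarith [hu _ (hev i)]
  have hle : ∀ i, 1 - c * hT.eigenvalues rfl i ≤ 1 - c * l := fun i => by
    linarith [mul_le_mul_of_nonneg_left (hl _ (hev i)) hc]
  have hpos : 0 ≤ 1 - c * l :=
    (hlow ⟨0, Module.finrank_pos⟩).trans (hle ⟨0, Module.finrank_pos⟩)
  refine le_of_sq_le_sq ?_ (by positivity)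
  set b := hT.eigenvectorBasis rfl
  rw [← b.repr.norm_map (x - c • T x), mul_pow, ← b.repr.norm_map x, EuclideanSpace.norm_sq_eq,
    EuclideanSpace.norm_sq_eq, Finset.mul_sum]
  refine Finset.sum_le_sum fun i _ => ?_
  have h : b.repr (x - c • T x) i = (1 - c * hT.eigenvalues rfl i) * b.repr x i := by
    have := hT.eigenvectorBasis_apply_self_apply rfl x i
    simp only [map_sub, map_smul, PiLp.sub_apply, PiLp.smul_apply, smul_eq_mul]
    rw [this]
    simp only [RCLike.ofReal_real_eq_id, id_eq]
    ring
  rw [h, norm_mul, mul_pow, Real.norm_of_nonneg (hlow i)]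
  gcongr
  · exact hlow i
  · exact hl _ (hev i)

theorem exists_orthogonal_norm_pow_sub_le {E : Type*} [NormedAddCommGroup E]
    [InnerProductSpace ℝ E] [FiniteDimensional ℝ E] {T : E →ₗ[ℝ] E} (hT : T.IsSymmetric)
    (hpos : ∀ x, 0 ≤ inner ℝ (T x) x) {c : ℝ} (hc : 0 ≤ c)
    (hub : ∀ x, c * inner ℝ (T x) x ≤ inner ℝ x x)
    (U : Submodule ℝ E) (hU : ∀ x ∈ U, T x ∈ U) {x : E} (hx : ‖x‖ ≤ 1)
    (k : ℕ) :
    ∃ h : E, (∀ u ∈ U, inner ℝ h u = 0) ∧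
      ‖((1 - c • T : Module.End ℝ E) ^ k) x - h‖ ≤
        (1 - c * sInf {μ : ℝ | ∃ f ∈ U, f ≠ 0 ∧ T f = μ • f}) ^ k := by
  set S := {μ : ℝ | ∃ f ∈ U, f ≠ 0 ∧ T f = μ • f} with hS
  set C : Module.End ℝ E := 1 - c • T with hC
  have hCapp : ∀ y, C y = y - c • T y := fun y => by simp [hC]
  have hnn : ∀ μ ∈ S, 0 ≤ μ ∧ c * μ ≤ 1 := by
    rintro μ ⟨f, -, hf, hTf⟩
    have h1 := hpos f
    have h2 := hub f
    rw [hTf, real_inner_smul_left] at h1 h2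
    have h3 : 0 < inner ℝ f f := real_inner_self_pos.2 hf
    exact ⟨nonneg_of_mul_nonneg_left h1 h3,
      le_of_mul_le_mul_right (by linarith) h3⟩
  have hbdd : BddBelow S := ⟨0, fun μ hμ => (hnn μ hμ).1⟩
  have hρ : 0 ≤ 1 - c * sInf S := by
    rcases S.eq_empty_or_nonempty with h | ⟨μ, hμ⟩
    · simp [h]
    · have := mul_le_mul_of_nonneg_left (csInf_le hbdd hμ) hc
      linarith [(hnn μ hμ).2]
  have hmem : ∀ μ : ℝ, Module.End.HasEigenvalue (T.restrict hU) μ → μ ∈ S := by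
    intro μ hμ
    obtain ⟨v, hv⟩ := hμ.exists_hasEigenvector
    refine ⟨v, v.2, fun h => hv.2 (Subtype.ext h), ?_⟩
    have := congrArg Subtype.val hv.apply_eq_smul
    simpa using this
  have hstep : ∀ u ∈ U, ‖C u‖ ≤ (1 - c * sInf S) * ‖u‖ := by
    intro u hu
    have := norm_sub_smul_le_of_eigenvalues (hT.restrict_invariant hU) hc
      (fun μ hμ => csInf_le hbdd (hmem μ hμ)) (fun μ hμ => (hnn μ (hmem μ hμ)).2) ⟨u, hu⟩
    rw [hCapp]
    simpa using this
  have hCU : ∀ u ∈ U, C u ∈ U := fun u hu => by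
    rw [hCapp]
    exact U.sub_mem hu (U.smul_mem _ (hU u hu))
  have hpow : ∀ (j : ℕ), ∀ u ∈ U, (C ^ j) u ∈ U ∧ ‖(C ^ j) u‖ ≤ (1 - c * sInf S) ^ j * ‖u‖ := by
    intro j u hu
    induction j with
    | zero => simpa using hu
    | succ j ih =>
      rw [pow_succ', Module.End.mul_apply]
      refine ⟨hCU _ ih.1, (hstep _ ih.1).trans ?_⟩
      rw [pow_succ', mul_assoc]
      exact mul_le_mul_of_nonneg_left ih.2 hρ
  have hCperp : ∀ y ∈ Uᗮ, C y ∈ Uᗮ := by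
    intro y hy
    rw [Submodule.mem_orthogonal] at hy ⊢
    intro u hu
    rw [hCapp, inner_sub_right, real_inner_smul_right, ← hT u y, hy u hu, hy _ (hU u hu)]
    simp
  have hpowperp : ∀ (j : ℕ), ∀ y ∈ Uᗮ, (C ^ j) y ∈ Uᗮ := by
    intro j y hy
    induction j with
    | zero => simpa using hy
    | succ j ih =>
      rw [pow_succ', Module.End.mul_apply]
      exact hCperp _ ih
  refine ⟨(C ^ k) (x - U.starProjection x), fun u hu => ?_, ?_⟩
  · exact Submodule.inner_left_of_mem_orthogonal hu
      (hpowperp k _ (U.sub_starProjection_mem_orthogonal x))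
  · rw [← map_sub, sub_sub_cancel]
    refine (hpow k _ (U.starProjection_apply_mem x)).2.trans ?_
    exact mul_le_of_le_one_right (pow_nonneg hρ k) ((U.norm_starProjection_apply_le x).trans hx)

theorem exists_orthogonal_sqrt_pow_sub_le {E : Type*} [AddCommGroup E] [Module ℝ E]
    [FiniteDimensional ℝ E] (I : InnerProductSpace.Core ℝ E) {T : E →ₗ[ℝ] E}
    (hT : ∀ x y, I.inner (T x) y = I.inner x (T y))
    (hpos : ∀ x, 0 ≤ I.inner (T x) x) {c : ℝ} (hc : 0 ≤ c)
    (hub : ∀ x, c * I.inner (T x) x ≤ I.inner x x)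
    (U : Submodule ℝ E) (hU : ∀ x ∈ U, T x ∈ U) {x : E}
    (hx : √(I.inner x x) ≤ 1) (k : ℕ) :
    ∃ h : E, (∀ u ∈ U, I.inner h u = 0) ∧
      √(I.inner (((1 - c • T : Module.End ℝ E) ^ k) x - h)
          (((1 - c • T : Module.End ℝ E) ^ k) x - h)) ≤
        (1 - c * sInf {μ : ℝ | ∃ f ∈ U, f ≠ 0 ∧ T f = μ • f}) ^ k := by
  let _ : NormedAddCommGroup E := I.toNormedAddCommGroup
  let _ : InnerProductSpace ℝ E := InnerProductSpace.ofCore I.toCore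
  exact exists_orthogonal_norm_pow_sub_le (T := T) hT hpos hc hub U hU hx k

/-- Riesz representation for an inner product core. -/
theorem exists_forall_inner_eq {E : Type*} [AddCommGroup E] [Module ℝ E]
    [FiniteDimensional ℝ E] (I : InnerProductSpace.Core ℝ E) (φ : E →ₗ[ℝ] ℝ) :
    ∃ g : E, ∀ y, φ y = I.inner g y := by
  let _ : NormedAddCommGroup E := I.toNormedAddCommGroup
  let _ : InnerProductSpace ℝ E := InnerProductSpace.ofCore I.toCore
  have : CompleteSpace E := FiniteDimensional.complete ℝ E
  refine ⟨(InnerProductSpace.toDual ℝ E).symm (LinearMap.toContinuousLinearMap φ), fun y => ?_⟩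
  exact (InnerProductSpace.toDual_symm_apply (x := y)
    (y := LinearMap.toContinuousLinearMap φ)).symm

/-- A functional orthogonal to the kernel of `D` is represented through `D`. -/
theorem exists_inner_comp_of_orthogonal_ker {E F : Type*} [AddCommGroup E] [Module ℝ E]
    [AddCommGroup F] [Module ℝ F] [FiniteDimensional ℝ F]
    (J : InnerProductSpace.Core ℝ F) (φ : E →ₗ[ℝ] ℝ) (D : E →ₗ[ℝ] F)
    (h : ∀ u, D u = 0 → φ u = 0) : ∃ g : F, ∀ y, φ y = J.inner g (D y) := by
  have hφ : φ ∈ LinearMap.range D.dualMap := by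
    rw [LinearMap.range_dualMap_eq_dualAnnihilator_ker, Submodule.mem_dualAnnihilator]
    exact fun u hu => h u hu
  obtain ⟨ψ, rfl⟩ := hφ
  obtain ⟨g, hg⟩ := exists_forall_inner_eq J ψ
  exact ⟨g, fun y => hg (D y)⟩

variable {V : Type*} {X : SComplex V} {n : ℕ}

theorem image_comp_perm (σ : Fin n → V) (π : Equiv.Perm (Fin n)) :
    Finset.image (σ ∘ π) Finset.univ = Finset.image σ Finset.univ := by
  ext v
  simp only [Finset.mem_image, Finset.mem_univ, true_and, Function.comp_apply]
  exact π.surjective.exists (p := fun a => σ a = v) |>.symm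

theorem isCellT_comp_perm (σ : Fin n → V) (π : Equiv.Perm (Fin n)) :
    X.IsCellT (σ ∘ π) ↔ X.IsCellT σ := by
  simp only [IsCellT, image_comp_perm, Function.Injective.of_comp_iff' _ π.bijective]

theorem degT_comp_perm (σ : Fin n → V) (π : Equiv.Perm (Fin n)) :
    X.degT (σ ∘ π) = X.degT σ := by
  simp only [degT, image_comp_perm]

theorem IsCellT.tail {v : V} {σ : Fin (n + 1) → V} (h : X.IsCellT (Fin.cons v σ)) :
    X.IsCellT σ := by
  refine ⟨(Fin.cons_injective_iff.1 h.1).2, X.down_closed h.2 ?_ (by simp)⟩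
  intro w hw
  obtain ⟨i, -, rfl⟩ := Finset.mem_image.1 hw
  exact Finset.mem_image.2 ⟨i.succ, by simp⟩

/-- Extension of a permutation of `Fin n` to `Fin (n + 1)` fixing `0`. -/
def extPerm (π : Equiv.Perm (Fin n)) : Equiv.Perm (Fin (n + 1)) :=
  Equiv.Perm.decomposeFin.symm (0, π)

theorem sign_extPerm (π : Equiv.Perm (Fin n)) :
    Equiv.Perm.sign (extPerm π) = Equiv.Perm.sign π := by
  simp [extPerm]

theorem cons_comp_extPerm (v : V) (σ : Fin n → V) (π : Equiv.Perm (Fin n)) :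
    (Fin.cons v σ : Fin (n + 1) → V) ∘ extPerm π = Fin.cons v (σ ∘ π) := by
  funext i
  refine Fin.cases ?_ (fun j => ?_) i <;> simp [extPerm]

theorem exists_extPerm_eq {ρ : Equiv.Perm (Fin (n + 1))} (h : ρ 0 = 0) :
    ∃ π, ρ = extPerm π := by
  obtain ⟨⟨q, π⟩, rfl⟩ := Equiv.Perm.decomposeFin.symm.surjective ρ
  rw [Equiv.Perm.decomposeFin_symm_apply_zero] at h
  exact ⟨π, by rw [h, extPerm]⟩

theorem comp_succAbove (τ : Fin (n + 1) → V) (i : Fin (n + 1)) :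
    τ ∘ i.succAbove = Fin.tail (τ ∘ i.cycleRange.symm) := by
  funext j
  simp [Fin.tail]

theorem IsCellT.comp_succAbove {τ : Fin (n + 2) → V} (h : X.IsCellT τ) (i : Fin (n + 2)) :
    X.IsCellT (τ ∘ i.succAbove) := by
  rw [SComplex.comp_succAbove]
  refine IsCellT.tail (v := (τ ∘ i.cycleRange.symm) 0) ?_
  rw [Fin.cons_self_tail]
  exact (isCellT_comp_perm _ _).2 h

theorem sign_cycleRange_cast (i : Fin n) :
    ((Equiv.Perm.sign i.cycleRange : ℤ) : ℝ) = (-1) ^ (i : ℕ) := by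
  simp [Fin.sign_cycleRange]

theorem IsForm.div_degT {f : (Fin n → V) → ℝ} (hf : X.IsForm n f) :
    X.IsForm n (fun σ => f σ / X.degT σ) := by
  refine ⟨fun σ h => by simp [hf.1 σ h], fun σ π => ?_⟩
  simp only [degT_comp_perm, hf.2 σ π, mul_div_assoc]

/-- The space of `(n-1)`-forms. -/
def forms (X : SComplex V) (n : ℕ) : Submodule ℝ ((Fin n → V) → ℝ) where
  carrier := {f | X.IsForm n f}
  add_mem' {f g} hf hg := ⟨fun σ h => by simp [hf.1 σ h, hg.1 σ h], fun σ π => by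
    simp only [Pi.add_apply, hf.2 σ π, hg.2 σ π, mul_add]⟩
  zero_mem' := ⟨fun _ _ => rfl, fun _ _ => by simp⟩
  smul_mem' c f hf := ⟨fun σ h => by simp [hf.1 σ h], fun σ π => by
    simp only [Pi.smul_apply, hf.2 σ π, smul_eq_mul]; ring⟩

/-- The coboundary `(∂* f)(τ) = Σ_i (-1)^i f(τ∖τ_i)/deg(τ∖τ_i)`. -/
def cobdry (X : SComplex V) (f : (Fin n → V) → ℝ) : (Fin (n + 1) → V) → ℝ := fun τ =>
  if X.IsCellT τ then
    ∑ i : Fin (n + 1), (-1 : ℝ) ^ (i : ℕ) * (f (τ ∘ i.succAbove) / X.degT (τ ∘ i.succAbove))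
  else 0

theorem IsForm.perm_comp_succAbove {f : (Fin n → V) → ℝ} (hf : X.IsForm n f)
    (τ : Fin (n + 1) → V) (π : Equiv.Perm (Fin (n + 1))) (i : Fin (n + 1)) :
    (-1 : ℝ) ^ (i : ℕ) * f ((τ ∘ π) ∘ i.succAbove) =
      ((Equiv.Perm.sign π : ℤ) : ℝ) *
        ((-1 : ℝ) ^ ((π i : Fin (n + 1)) : ℕ) * f (τ ∘ (π i).succAbove)) := by
  obtain ⟨ρ, hρ⟩ := exists_extPerm_eq (ρ := (π i).cycleRange * π * i.cycleRange⁻¹)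
    (by simp [Equiv.Perm.mul_apply, Equiv.Perm.inv_def])
  have hcomp : (τ ∘ π) ∘ i.succAbove = (τ ∘ (π i).succAbove) ∘ ρ := by
    funext j
    have := congrArg (fun q => (π i).cycleRange.symm (q j.succ)) hρ
    simp only [Equiv.Perm.mul_apply, Equiv.Perm.inv_def, Equiv.symm_apply_apply,
      Fin.cycleRange_symm_succ] at this
    simp [this, extPerm]
  have hsign : ((Equiv.Perm.sign ρ : ℤ) : ℝ) =
      (-1) ^ ((π i : Fin (n + 1)) : ℕ) * ((Equiv.Perm.sign π : ℤ) : ℝ) * (-1) ^ (i : ℕ) := by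
    rw [← sign_extPerm, ← hρ, ← sign_cycleRange_cast, ← sign_cycleRange_cast]
    simp
  have hsq : (-1 : ℝ) ^ (i : ℕ) * (-1 : ℝ) ^ (i : ℕ) = 1 := by
    rw [← mul_pow]; simp
  rw [hcomp, hf.2, hsign]
  linear_combination ((-1) ^ ((π i : Fin (n + 1)) : ℕ) * ((Equiv.Perm.sign π : ℤ) : ℝ) *
    f (τ ∘ (π i).succAbove)) * hsq

theorem IsForm.cobdry {f : (Fin n → V) → ℝ} (hf : X.IsForm n f) :
    X.IsForm (n + 1) (X.cobdry f) := by
  refine ⟨fun σ h => if_neg h, fun τ π => ?_⟩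
  simp only [SComplex.cobdry, isCellT_comp_perm]
  split_ifs
  · rw [← Equiv.sum_comp π (fun i => _ * (f (τ ∘ i.succAbove) / _)), Finset.mul_sum]
    exact Finset.sum_congr rfl fun i _ => hf.div_degT.perm_comp_succAbove τ π i
  · simp

theorem IsForm.dirac {σ₀ : Fin n → V} (h₀ : X.IsCellT σ₀) : X.IsForm n (dirac σ₀) := by
  have huniq : ∀ π ρ : Equiv.Perm (Fin n), σ₀ ∘ π = σ₀ ∘ ρ → π = ρ := fun π ρ h =>
    Equiv.ext fun i => h₀.1 (congrFun h i)
  have hval : ∀ π : Equiv.Perm (Fin n),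
      SComplex.dirac σ₀ (σ₀ ∘ π) = ((Equiv.Perm.sign π : ℤ) : ℝ) := by
    intro π
    have key : ∀ u : ℤˣ, (∃ ρ : Equiv.Perm (Fin n), Equiv.Perm.sign ρ = u ∧ σ₀ ∘ π = σ₀ ∘ ρ) ↔
        Equiv.Perm.sign π = u :=
      fun u => ⟨fun ⟨ρ, h, h'⟩ => huniq _ _ h' ▸ h, fun h => ⟨π, h, rfl⟩⟩
    rw [SComplex.dirac, if_congr (key 1) rfl (if_congr (key (-1)) rfl rfl)]
    rcases Int.units_eq_one_or (Equiv.Perm.sign π) with h | h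
    · simp [h]
    · simp [h]
  have hzero : ∀ σ, (¬ ∃ π : Equiv.Perm (Fin n), σ = σ₀ ∘ π) → SComplex.dirac σ₀ σ = 0 := by
    intro σ h
    rw [SComplex.dirac, if_neg fun ⟨π, hπ⟩ => h ⟨π, hπ.2⟩, if_neg fun ⟨π, hπ⟩ => h ⟨π, hπ.2⟩]
  refine ⟨fun σ hσ => hzero σ ?_, fun σ π => ?_⟩
  · rintro ⟨π, rfl⟩
    exact hσ ((isCellT_comp_perm _ _).2 h₀)
  · by_cases h : ∃ ρ : Equiv.Perm (Fin n), σ = σ₀ ∘ ρ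
    · obtain ⟨ρ, rfl⟩ := h
      have : (σ₀ ∘ ρ) ∘ π = σ₀ ∘ (ρ * π : Equiv.Perm (Fin n)) := rfl
      rw [this, hval, hval, Equiv.Perm.sign_mul]
      push_cast
      ring
    · rw [hzero σ h, hzero (σ ∘ π), mul_zero]
      rintro ⟨ρ, hρ⟩
      refine h ⟨ρ * π⁻¹, ?_⟩
      funext i
      have := congrFun hρ (π⁻¹ i)
      simpa using this

variable [Fintype V]

theorem IsForm.bdry_apply {f : (Fin (n + 1) → V) → ℝ} (hf : X.IsForm (n + 1) f)
    (σ : Fin n → V) : X.bdry f σ = ∑ v, f (Fin.cons v σ) := by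
  rw [bdry, ← finsum_eq_sum_of_fintype, finsum_mem_def]
  refine finsum_congr fun v => ?_
  rw [Set.indicator_apply]
  split_ifs with h
  · rfl
  · exact (hf.1 _ h).symm

theorem IsForm.bdry {f : (Fin (n + 2) → V) → ℝ} (hf : X.IsForm (n + 2) f) :
    X.IsForm (n + 1) (X.bdry f) := by
  refine ⟨fun σ h => ?_, fun σ π => ?_⟩
  · rw [hf.bdry_apply]
    exact Finset.sum_eq_zero fun v _ => hf.1 _ fun h' => h h'.tail
  · rw [hf.bdry_apply, hf.bdry_apply, Finset.mul_sum]
    refine Finset.sum_congr rfl fun v _ => ?_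
    rw [← cons_comp_extPerm, hf.2, sign_extPerm]

theorem IsForm.bdry_bdry {f : (Fin (n + 3) → V) → ℝ} (hf : X.IsForm (n + 3) f) :
    X.bdry (X.bdry f) = 0 := by
  funext σ
  have h : X.bdry (X.bdry f) σ = ∑ v, ∑ w, f (Fin.cons w (Fin.cons v σ)) := by
    rw [hf.bdry.bdry_apply]
    exact Finset.sum_congr rfl fun v _ => hf.bdry_apply _
  have hswap : ∀ v w, f (Fin.cons w (Fin.cons v σ)) = - f (Fin.cons v (Fin.cons w σ)) := by
    intro v w
    have := hf.2 (Fin.cons v (Fin.cons w σ)) (Equiv.swap 0 1)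
    rw [Equiv.Perm.sign_swap (by simp)] at this
    have hc : (Fin.cons v (Fin.cons w σ) : Fin (n + 3) → V) ∘ Equiv.swap 0 1 =
        Fin.cons w (Fin.cons v σ) := by
      funext i
      refine Fin.cases ?_ (fun j => Fin.cases ?_ (fun k => ?_) j) i
      · simp
      · simp
      · have : Equiv.swap (0 : Fin (n + 3)) 1 k.succ.succ = k.succ.succ :=
          Equiv.swap_apply_of_ne_of_ne (Fin.succ_ne_zero _)
            (fun h => Fin.succ_ne_zero k (Fin.succ_injective _ h))
        simp [this]
    rw [hc] at this
    simpa using this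
  have h2 : X.bdry (X.bdry f) σ = - X.bdry (X.bdry f) σ := by
    conv_lhs => rw [h, Finset.sum_comm]
    rw [h, ← Finset.sum_neg_distrib]
    refine Finset.sum_congr rfl fun v _ => ?_
    rw [← Finset.sum_neg_distrib]
    exact Finset.sum_congr rfl fun w _ => hswap w v
  simp only [Pi.zero_apply]
  linarith

/-- The number of vertices extending a cell is its degree. -/
theorem card_cons_eq_degT {σ : Fin n → V} (hσ : Function.Injective σ) :
    (Finset.univ.filter fun v => X.IsCellT (Fin.cons v σ)).card = X.degT σ := by
  have himg : ∀ v, Finset.image (Fin.cons v σ : Fin (n + 1) → V) Finset.univ =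
      insert v (Finset.image σ Finset.univ) := by
    intro v
    ext w
    simp [Fin.exists_fin_succ, eq_comm]
  have hcell : ∀ v, X.IsCellT (Fin.cons v σ : Fin (n + 1) → V) ↔
      v ∉ Finset.image σ Finset.univ ∧ insert v (Finset.image σ Finset.univ) ∈ X.cells := by
    intro v
    rw [IsCellT, himg, Fin.cons_injective_iff]
    simp [hσ]
  rw [degT, degS, ← Set.ncard_coe_finset]
  refine Set.ncard_congr (fun v _ => insert v (Finset.image σ Finset.univ)) ?_ ?_ ?_
  · intro v hv
    have hv := (hcell v).1 (by simpa using hv)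
    exact ⟨hv.2, Finset.card_insert_of_notMem hv.1, Finset.subset_insert _ _⟩
  · intro v w hv hw h
    have hv := (hcell v).1 (by simpa using hv)
    have hmem : v ∈ insert w (Finset.image σ Finset.univ) := h ▸ Finset.mem_insert_self _ _
    exact (Finset.mem_insert.1 hmem).resolve_right hv.1
  · rintro t ⟨ht, hcard, hsub⟩
    obtain ⟨v, hv, rfl⟩ := Finset.exists_eq_insert_iff.2 ⟨hsub, hcard.symm⟩
    exact ⟨v, by simpa using (hcell v).2 ⟨hv, ht⟩, rfl⟩

/-- `Δ⁺ = ∂ ∂*`. -/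
theorem IsForm.lapUp_eq {f : (Fin (n + 1) → V) → ℝ} (hf : X.IsForm (n + 1) f)
    (hdeg : ∀ σ : Fin (n + 1) → V, X.IsCellT σ → X.degT σ ≠ 0) :
    X.lapUp f = X.bdry (X.cobdry f) := by
  funext σ
  have hcob : ∀ v, X.cobdry f (Fin.cons v σ) =
      if X.IsCellT (Fin.cons v σ) then f σ / X.degT σ -
        ∑ i : Fin (n + 1), (-1 : ℝ) ^ (i : ℕ) * f (Fin.cons v (σ ∘ i.succAbove)) /
          (X.degT (Fin.cons v (σ ∘ i.succAbove)) : ℝ) else 0 := by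
    intro v
    rw [SComplex.cobdry]
    refine if_congr Iff.rfl ?_ rfl
    have hs : ∀ i : Fin (n + 1), (Fin.cons v σ : Fin (n + 2) → V) ∘ i.succ.succAbove =
        Fin.cons v (σ ∘ i.succAbove) := by
      intro i
      funext j
      refine Fin.cases ?_ (fun k => ?_) j <;> simp
    have h0 : (Fin.cons v σ : Fin (n + 2) → V) ∘ (0 : Fin (n + 2)).succAbove = σ := by
      funext j
      simp
    rw [Fin.sum_univ_succ, h0, sub_eq_add_neg, ← Finset.sum_neg_distrib]
    simp only [hs, Fin.val_zero, pow_zero, one_mul, Fin.val_succ, pow_succ]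
    congr 1
    exact Finset.sum_congr rfl fun i _ => by ring
  have hn : X.nbrW f σ = ∑ v, if X.IsCellT (Fin.cons v σ) then
        ∑ i : Fin (n + 1), (-1 : ℝ) ^ (i : ℕ) * f (Fin.cons v (σ ∘ i.succAbove)) /
          (X.degT (Fin.cons v (σ ∘ i.succAbove)) : ℝ) else 0 := by
    rw [nbrW, ← finsum_eq_sum_of_fintype, finsum_mem_def]
    exact finsum_congr fun v => Set.indicator_apply _ _ _
  have hmain : f σ = ∑ v, if X.IsCellT (Fin.cons v σ) then f σ / X.degT σ else 0 := by
    rw [← Finset.sum_filter, Finset.sum_const, nsmul_eq_mul]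
    by_cases h : X.IsCellT σ
    · rw [card_cons_eq_degT h.1, mul_div_cancel₀]
      exact_mod_cast hdeg σ h
    · simp [hf.1 σ h]
  rw [lapUp, hf.cobdry.bdry_apply, hn]
  conv_lhs => rw [hmain]
  rw [← Finset.sum_sub_distrib]
  refine Finset.sum_congr rfl fun v _ => ?_
  rw [hcob]
  split_ifs <;> simp

theorem sum_comp_perm (G : (Fin n → V) → ℝ) (π : Equiv.Perm (Fin n)) :
    ∑ τ : Fin n → V, G (τ ∘ π) = ∑ τ, G τ :=
  Equiv.sum_comp (Equiv.arrowCongr π.symm (Equiv.refl V)) G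

theorem sum_eq_sum_cons (G : (Fin (n + 1) → V) → ℝ) :
    ∑ τ, G τ = ∑ σ : Fin n → V, ∑ v, G (Fin.cons v σ) := by
  rw [← (Fin.consEquiv (fun _ => V)).sum_comp, Fintype.sum_prod_type, Finset.sum_comm]
  rfl

/-- The operators `∂` and `∂*` are adjoint. -/
theorem innerW_bdry {f : (Fin (n + 1) → V) → ℝ} {g : (Fin (n + 2) → V) → ℝ}
    (hg : X.IsForm (n + 2) g) : X.innerW f (X.bdry g) = innerU (X.cobdry f) g := by
  have h1 : ∀ τ, X.cobdry f τ * g τ = ∑ i : Fin (n + 2),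
      (f (Fin.tail (τ ∘ i.cycleRange.symm)) / X.degT (Fin.tail (τ ∘ i.cycleRange.symm)) *
        g (τ ∘ i.cycleRange.symm)) := by
    intro τ
    by_cases h : X.IsCellT τ
    · rw [cobdry, if_pos h, Finset.sum_mul]
      refine Finset.sum_congr rfl fun i _ => ?_
      rw [comp_succAbove, hg.2, Equiv.Perm.sign_symm, sign_cycleRange_cast]
      ring
    · rw [hg.1 τ h, mul_zero]
      refine (Finset.sum_eq_zero fun i _ => ?_).symm
      rw [hg.1 _ fun h' => h ((isCellT_comp_perm _ _).1 h'), mul_zero]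
  rw [innerU, Finset.sum_congr rfl fun τ _ => h1 τ, Finset.sum_comm]
  simp_rw [fun i : Fin (n + 2) => sum_comp_perm (fun τ : Fin (n + 2) → V =>
    f (Fin.tail τ) / X.degT (Fin.tail τ) * g τ) i.cycleRange.symm]
  rw [Finset.sum_const, Finset.card_univ, Fintype.card_fin, nsmul_eq_mul, sum_eq_sum_cons,
    innerW, Nat.factorial_succ (n + 1)]
  have h2 : ∀ σ : Fin (n + 1) → V, ∑ v, f (Fin.tail (Fin.cons v σ : Fin (n + 2) → V)) /
      X.degT (Fin.tail (Fin.cons v σ : Fin (n + 2) → V)) * g (Fin.cons v σ) =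
      f σ * X.bdry g σ / X.degT σ := by
    intro σ
    simp only [Fin.tail_cons]
    rw [← Finset.mul_sum, hg.bdry_apply]
    ring
  simp_rw [h2]
  have : ((n + 1).factorial : ℝ) ≠ 0 := by positivity
  push_cast
  field_simp
  ring

theorem innerU_cobdry_le {f : (Fin (n + 1) → V) → ℝ} (hf : X.IsForm (n + 1) f) :
    innerU (X.cobdry f) (X.cobdry f) ≤ ((n : ℝ) + 2) * X.innerW f f := by
  set G : (Fin (n + 2) → V) → ℝ := fun τ =>
    if X.IsCellT τ then (f (Fin.tail τ) / X.degT (Fin.tail τ)) ^ 2 else 0 with hG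
  have h1 : ∀ τ, X.cobdry f τ * X.cobdry f τ ≤
      ((n : ℝ) + 2) * ∑ i : Fin (n + 2), G (τ ∘ i.cycleRange.symm) := by
    intro τ
    by_cases h : X.IsCellT τ
    · rw [cobdry, if_pos h, ← sq]
      refine sq_sum_le_card_mul_sum_sq.trans (le_of_eq ?_)
      have hsq : ∀ k : ℕ, ((-1 : ℝ) ^ k) ^ 2 = 1 := fun k => by rw [← pow_mul]; simp
      simp [hG, isCellT_comp_perm, h, ← comp_succAbove, mul_pow, hsq]
      left
      ring
    · rw [cobdry, if_neg h]
      simp [hG, isCellT_comp_perm, h]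
  have h2 : ∑ τ, G τ = ∑ σ, f σ * f σ / X.degT σ := by
    rw [sum_eq_sum_cons]
    refine Finset.sum_congr rfl fun σ _ => ?_
    simp only [hG, Fin.tail_cons]
    rw [← Finset.sum_filter, Finset.sum_const, nsmul_eq_mul]
    by_cases h : X.IsCellT σ
    · rw [card_cons_eq_degT h.1]
      rcases eq_or_ne (X.degT σ : ℝ) 0 with h0 | h0
      · simp [h0]
      · field_simp
    · simp [hf.1 σ h]
  have h3 : ∑ τ, X.cobdry f τ * X.cobdry f τ ≤
      ((n : ℝ) + 2) * (((n : ℝ) + 2) * ∑ σ, f σ * f σ / X.degT σ) := by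
    refine (Finset.sum_le_sum fun τ _ => h1 τ).trans (le_of_eq ?_)
    rw [← Finset.mul_sum, Finset.sum_comm]
    simp_rw [fun i : Fin (n + 2) => sum_comp_perm G i.cycleRange.symm]
    rw [Finset.sum_const, Finset.card_univ, Fintype.card_fin, nsmul_eq_mul, h2]
    push_cast
    ring
  rw [innerU, innerW, Nat.factorial_succ (n + 1)]
  have : (0 : ℝ) < ((n + 1).factorial : ℝ) := by positivity
  push_cast
  rw [one_div, inv_mul_le_iff₀ (by positivity)]
  refine h3.trans (le_of_eq ?_)
  field_simp
  ring

theorem innerW_dirac_le_one (σ₀ : Fin n → V) :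
    X.innerW (dirac σ₀) (dirac σ₀) ≤ 1 := by
  have hle : ∀ σ, dirac σ₀ σ * dirac σ₀ σ / (X.degT σ : ℝ) ≤
      if σ ∈ Finset.univ.image (fun π : Equiv.Perm (Fin n) => σ₀ ∘ π) then 1 else 0 := by
    intro σ
    have hd : (X.degT σ : ℝ)⁻¹ ≤ 1 := Nat.cast_inv_le_one _
    unfold dirac
    split_ifs with h1 h2 h3 h4 h5
    · simpa using hd
    · exact absurd (by obtain ⟨π, -, h⟩ := h1; simpa using ⟨π, h.symm⟩) h2
    · simpa using hd
    · exact absurd (by obtain ⟨π, -, h⟩ := h3; simpa using ⟨π, h.symm⟩) h4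
    · simp
    · simp
  rw [innerW, one_div, inv_mul_le_iff₀ (by positivity), mul_one]
  refine (Finset.sum_le_sum fun σ _ => hle σ).trans ?_
  rw [Finset.sum_ite_mem, Finset.univ_inter, Finset.sum_const, nsmul_eq_mul, mul_one]
  have := Finset.card_image_le (s := Finset.univ) (f := fun π : Equiv.Perm (Fin n) => σ₀ ∘ π)
  rw [Finset.card_univ, Fintype.card_perm, Fintype.card_fin] at this
  exact_mod_cast this

theorem innerW_comm (f g : (Fin n → V) → ℝ) : X.innerW f g = X.innerW g f := by
  simp only [innerW, mul_comm]

theorem innerW_add_left (f g h : (Fin n → V) → ℝ) :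
    X.innerW (f + g) h = X.innerW f h + X.innerW g h := by
  simp only [innerW, Pi.add_apply, add_mul, add_div, Finset.sum_add_distrib, mul_add]

theorem innerW_smul_left (c : ℝ) (f g : (Fin n → V) → ℝ) :
    X.innerW (c • f) g = c * X.innerW f g := by
  simp only [innerW, Pi.smul_apply, smul_eq_mul, mul_assoc, mul_div_assoc, ← Finset.mul_sum]
  ring

theorem innerW_add_right (f g h : (Fin n → V) → ℝ) :
    X.innerW f (g + h) = X.innerW f g + X.innerW f h := by
  rw [innerW_comm, innerW_add_left, innerW_comm g, innerW_comm h]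

theorem innerW_smul_right (c : ℝ) (f g : (Fin n → V) → ℝ) :
    X.innerW f (c • g) = c * X.innerW f g := by
  rw [innerW_comm, innerW_smul_left, innerW_comm]

theorem innerW_self_nonneg (f : (Fin n → V) → ℝ) : 0 ≤ X.innerW f f :=
  mul_nonneg (by positivity) (Finset.sum_nonneg fun σ _ =>
    div_nonneg (mul_self_nonneg _) (Nat.cast_nonneg _))

theorem innerU_self_nonneg (f : (Fin n → V) → ℝ) : 0 ≤ innerU f f :=
  mul_nonneg (by positivity) (Finset.sum_nonneg fun σ _ => mul_self_nonneg _)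

/-- The weighted inner product on forms, when all degrees are positive. -/
@[reducible]
def coreW (hdeg : ∀ σ : Fin n → V, X.IsCellT σ → X.degT σ ≠ 0) :
    InnerProductSpace.Core ℝ (X.forms n) where
  inner f g := X.innerW (n := n) f g
  conj_inner_symm f g := innerW_comm (X := X) (g : (Fin n → V) → ℝ) f
  re_inner_nonneg f := innerW_self_nonneg _
  add_left f g h := innerW_add_left _ _ _
  smul_left f g c := innerW_smul_left c (f : (Fin n → V) → ℝ) g
  definite f hf := by
    ext σ
    by_cases h : X.IsCellT σ
    · have h0 := (mul_eq_zero.1 hf).resolve_left (by positivity)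
      rw [Finset.sum_eq_zero_iff_of_nonneg fun (σ : Fin n → V) _ =>
        div_nonneg (mul_self_nonneg _) (Nat.cast_nonneg _)] at h0
      have := (div_eq_zero_iff.1 (h0 σ (Finset.mem_univ σ))).resolve_right
        (by exact_mod_cast hdeg σ h)
      simpa using this
    · exact f.2.1 σ h

/-- The unweighted inner product on forms. -/
@[reducible]
def coreU (X : SComplex V) (n : ℕ) : InnerProductSpace.Core ℝ (X.forms n) where
  inner f g := innerU (f : (Fin n → V) → ℝ) g
  conj_inner_symm f g := by simp only [innerU, mul_comm]; rfl
  re_inner_nonneg f := innerU_self_nonneg _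
  add_left f g h := by
    simp only [innerU, Submodule.coe_add, Pi.add_apply, add_mul, Finset.sum_add_distrib, mul_add]
  smul_left f g c := by
    simp only [innerU, Submodule.coe_smul, Pi.smul_apply, smul_eq_mul, mul_assoc,
      ← Finset.mul_sum, conj_trivial]
    ring
  definite f hf := by
    ext σ
    have h0 := (mul_eq_zero.1 hf).resolve_left (by positivity)
    rw [Finset.sum_eq_zero_iff_of_nonneg fun σ _ => mul_self_nonneg _] at h0
    simpa using h0 σ (Finset.mem_univ σ)

/-- The boundary operator as a linear map on forms. -/
def bdryL (X : SComplex V) (n : ℕ) : X.forms (n + 2) →ₗ[ℝ] X.forms (n + 1) where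
  toFun f := ⟨X.bdry f, f.2.bdry⟩
  map_add' f g := by
    ext σ
    refine ((f + g).2.bdry_apply σ).trans ?_
    simp only [Submodule.coe_add, Pi.add_apply, f.2.bdry_apply, g.2.bdry_apply,
      Finset.sum_add_distrib]
  map_smul' c f := by
    ext σ
    refine ((c • f).2.bdry_apply σ).trans ?_
    simp only [Submodule.coe_smul, Pi.smul_apply, f.2.bdry_apply,
      smul_eq_mul, Finset.mul_sum, RingHom.id_apply]

/-- The coboundary operator as a linear map on forms. -/
def cobdryL (X : SComplex V) (n : ℕ) : X.forms n →ₗ[ℝ] X.forms (n + 1) where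
  toFun f := ⟨X.cobdry f, f.2.cobdry⟩
  map_add' f g := by
    ext σ
    simp only [cobdry, Submodule.coe_add, Pi.add_apply]
    split_ifs
    · rw [← Finset.sum_add_distrib]
      exact Finset.sum_congr rfl fun i _ => by ring
    · simp
  map_smul' c f := by
    ext σ
    simp only [cobdry, Submodule.coe_smul, Pi.smul_apply, RingHom.id_apply, smul_eq_mul]
    split_ifs
    · rw [Finset.mul_sum]
      exact Finset.sum_congr rfl fun i _ => by ring
    · simp

/-- The upper Laplacian as a linear map on forms. -/
def lapL (X : SComplex V) (n : ℕ) : X.forms (n + 1) →ₗ[ℝ] X.forms (n + 1) :=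
  X.bdryL n ∘ₗ X.cobdryL (n + 1)

theorem coe_lapL (hdeg : ∀ σ : Fin (n + 1) → V, X.IsCellT σ → X.degT σ ≠ 0)
    (f : X.forms (n + 1)) : (X.lapL n f : (Fin (n + 1) → V) → ℝ) = X.lapUp f :=
  (f.2.lapUp_eq hdeg).symm

theorem innerW_lapL (f g : X.forms (n + 1)) :
    X.innerW (n := n + 1) f (X.lapL n g) = innerU (X.cobdry (f : (Fin (n + 1) → V) → ℝ)) (X.cobdry g) :=
  innerW_bdry g.2.cobdry

/-- The normalized transition operator is `1 - cΔ⁺`. -/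
theorem nexp_eq (hdeg : ∀ σ : Fin (n + 1) → V, X.IsCellT σ → X.degT σ ≠ 0) {p : ℝ}
    (hp : 0 ≤ p) {σ₀ : Fin (n + 1) → V} (h₀ : X.IsCellT σ₀) (k : ℕ) :
    X.nexp p σ₀ k = ((1 - ((1 - p) / (p * n + 1)) • X.lapL n : Module.End ℝ (X.forms (n + 1))) ^ k)
      ⟨dirac σ₀, IsForm.dirac h₀⟩ := by
  set C : Module.End ℝ (X.forms (n + 1)) := 1 - ((1 - p) / (p * n + 1)) • X.lapL n with hC
  set s : ℝ := ((n : ℝ) + 1) / (p * n + 1) with hs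
  have hpn : 0 < p * n + 1 := by positivity
  have hs0 : s ≠ 0 := by positivity
  have hstep : ∀ (f : X.forms (n + 1)) (a : ℝ),
      X.transOp p (a • (f : (Fin (n + 1) → V) → ℝ)) = (a * s⁻¹) • (C f : (Fin (n + 1) → V) → ℝ) := by
    intro f a
    have h1 : (C (a • f) : (Fin (n + 1) → V) → ℝ) = a • (C f : (Fin (n + 1) → V) → ℝ) := by
      rw [map_smul, Submodule.coe_smul]
    have h2 : (C (a • f) : (Fin (n + 1) → V) → ℝ) = a • (f : (Fin (n + 1) → V) → ℝ) -
        ((1 - p) / (p * n + 1)) • X.lapUp (a • (f : (Fin (n + 1) → V) → ℝ)) := by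
      rw [hC, LinearMap.sub_apply, LinearMap.smul_apply, Submodule.coe_sub, Submodule.coe_smul,
        coe_lapL hdeg]
      rfl
    rw [mul_comm, mul_smul, ← h1, h2]
    funext σ
    simp only [transOp, lapUp, Pi.smul_apply, Pi.sub_apply, smul_eq_mul, hs]
    field_simp
    ring
  have hiter : ∀ k, (X.transOp p)^[k] (dirac σ₀) =
      (s⁻¹) ^ k • (((C ^ k) ⟨dirac σ₀, IsForm.dirac h₀⟩ : X.forms (n + 1)) :
        (Fin (n + 1) → V) → ℝ) := by
    intro k
    induction k with
    | zero => simp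
    | succ k ih =>
      rw [Function.iterate_succ_apply', ih, hstep, ← pow_succ, pow_succ' C, Module.End.mul_apply]
  rw [nexp, hiter, smul_smul, ← hs, ← mul_pow, mul_inv_cancel₀ hs0, one_pow, one_smul]

theorem degT_ne_zero {N : ℕ} (huni : ∀ s ∈ X.cells, ∃ t ∈ X.cells, t.card = N + 1 ∧ s ⊆ t)
    {σ : Fin N → V} (hσ : X.IsCellT σ) : X.degT σ ≠ 0 := by
  obtain ⟨t, ht, hcard, hsub⟩ := huni _ hσ.2
  refine ((Set.ncard_pos (Set.toFinite _)).2 ?_).ne'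
  refine ⟨t, ht, ?_, hsub⟩
  rw [hcard, Finset.card_image_of_injective _ hσ.1, Finset.card_univ, Fintype.card_fin]

/-- Distance decay along a `Δ⁺`-invariant subspace of forms. -/
theorem exists_orthogonal_normW_nexp_le
    (hdeg : ∀ σ : Fin (n + 1) → V, X.IsCellT σ → X.degT σ ≠ 0) {p : ℝ} (hp₁ : 1 / 2 ≤ p)
    (hp₂ : p < 1) {σ₀ : Fin (n + 1) → V} (h₀ : X.IsCellT σ₀)
    (U : Submodule ℝ (X.forms (n + 1))) (hU : ∀ f ∈ U, X.lapL n f ∈ U) (k : ℕ) :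
    ∃ h : X.forms (n + 1), (∀ u ∈ U, X.innerW (n := n + 1) h u = 0) ∧
      X.normW (X.nexp p σ₀ k - (h : (Fin (n + 1) → V) → ℝ)) ≤ (1 - (1 - p) / (p * n + 1) *
        sInf {μ : ℝ | ∃ f ∈ U, f ≠ 0 ∧ X.lapL n f = μ • f}) ^ k := by
  have hc : 0 ≤ (1 - p) / (p * n + 1) := div_nonneg (by linarith) (by positivity)
  have hsym : ∀ f g : X.forms (n + 1), X.innerW (n := n + 1) (X.lapL n f) g =
      X.innerW (n := n + 1) f (X.lapL n g) := by
    intro f g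
    rw [innerW_comm, innerW_lapL, innerW_lapL]
    simp only [innerU, mul_comm]
  have hpos : ∀ f : X.forms (n + 1), 0 ≤ X.innerW (n := n + 1) (X.lapL n f) f := by
    intro f
    rw [hsym, innerW_lapL]
    exact innerU_self_nonneg _
  have hub : ∀ f : X.forms (n + 1),
      (1 - p) / (p * n + 1) * X.innerW (n := n + 1) (X.lapL n f) f ≤
        X.innerW (n := n + 1) f f := by
    intro f
    rw [hsym, innerW_lapL]
    have h1 := innerU_cobdry_le f.2
    have h2 := innerW_self_nonneg (X := X) (f : (Fin (n + 1) → V) → ℝ)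
    have h3 : (1 - p) / (p * n + 1) * ((n : ℝ) + 2) ≤ 1 := by
      rw [div_mul_eq_mul_div, div_le_one (by positivity)]
      nlinarith [(Nat.cast_nonneg n : (0 : ℝ) ≤ n)]
    calc _ ≤ (1 - p) / (p * n + 1) * (((n : ℝ) + 2) * X.innerW (n := n + 1) f f) :=
          mul_le_mul_of_nonneg_left h1 hc
      _ = (1 - p) / (p * n + 1) * ((n : ℝ) + 2) * X.innerW (n := n + 1) f f := by ring
      _ ≤ 1 * X.innerW (n := n + 1) f f := mul_le_mul_of_nonneg_right h3 h2
      _ = _ := one_mul _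
  obtain ⟨h, hh, hle⟩ := exists_orthogonal_sqrt_pow_sub_le (coreW hdeg) hsym hpos hc hub U hU
    (x := ⟨dirac σ₀, IsForm.dirac h₀⟩) (Real.sqrt_le_one.2 (innerW_dirac_le_one σ₀)) k
  refine ⟨h, hh, ?_⟩
  rw [nexp_eq hdeg (by linarith) h₀]
  exact hle

theorem isExactForm_of_orthogonal {m : ℕ} (h : X.forms (m + 2))
    (hh : ∀ u : X.forms (m + 2), X.bdry (n := m + 1) u = 0 → X.innerW (n := m + 2) h u = 0) :
    X.IsExactForm m h := by
  let φ : X.forms (m + 2) →ₗ[ℝ] ℝ :=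
    { toFun := fun u => X.innerW (n := m + 2) h u
      map_add' := fun u v => innerW_add_right _ _ _
      map_smul' := fun c u => innerW_smul_right c _ (u : (Fin (m + 2) → V) → ℝ) }
  obtain ⟨g, hg⟩ := exists_inner_comp_of_orthogonal_ker (X.coreU (m + 1)) φ (X.bdryL m)
    fun u hu => hh u (congrArg Subtype.val hu)
  exact ⟨h.2, g, g.2, fun u hu => hg ⟨u, hu⟩⟩

theorem sInf_normW_le {f h : (Fin n → V) → ℝ} {P : ((Fin n → V) → ℝ) → Prop} {r : ℝ}
    (hP : P h) (hr : X.normW (f - h) ≤ r) : sInf {r : ℝ | ∃ h, P h ∧ r = X.normW (f - h)} ≤ r := by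
  refine le_trans (csInf_le ⟨0, ?_⟩ ?_) hr
  swap
  · exact ⟨h, hP, rfl⟩
  rintro _ ⟨h, -, rfl⟩
  exact Real.sqrt_nonneg _

end SComplex

open SComplex

/-- For a finite uniform `d`-dimensional complex (`d = m+2 ≥ 2`) and
`1/2 ≤ p < 1`, the normalized expectation process satisfies
`dist(Ẽ_n^σ, B^{d-1}) ≤ (1 - ((1-p)/(p(d-1)+1))·λ(X))^n` and
`dist(Ẽ_n^σ, Z^{d-1}) ≤ (1 - ((1-p)/(p(d-1)+1))·λ̃(X))^n`, where
`λ(X) = min Spec(Δ⁺|_{ker ∂_{d-1}})` and `λ̃(X) = min Spec(Δ⁺|_{im ∂_d})`. -/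
theorem stmt1 {V : Type*} [Fintype V] (m : ℕ) (X : SComplex V)
    (hdim : ∀ s ∈ X.cells, s.card ≤ m + 3)
    (huni : ∀ s ∈ X.cells, ∃ t ∈ X.cells, t.card = m + 3 ∧ s ⊆ t)
    (htop : ∃ s ∈ X.cells, s.card = m + 3)
    (p : ℝ) (hp₁ : 1 / 2 ≤ p) (hp₂ : p < 1) :
    ∀ σ₀ : Fin (m + 2) → V, X.IsCellT σ₀ → ∀ nn : ℕ,
      sInf {r : ℝ | ∃ h, X.IsExactForm m h ∧ r = X.normW (X.nexp p σ₀ nn - h)} ≤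
        (1 - (1 - p) / (p * ((m : ℝ) + 1) + 1) *
            sInf {μ : ℝ | ∃ f : (Fin (m + 2) → V) → ℝ, X.IsForm (m + 2) f ∧ f ≠ 0 ∧
              X.bdry f = 0 ∧ X.lapUp f = μ • f}) ^ nn ∧
      sInf {r : ℝ | ∃ h, X.IsClosedForm m h ∧ r = X.normW (X.nexp p σ₀ nn - h)} ≤
        (1 - (1 - p) / (p * ((m : ℝ) + 1) + 1) *
            sInf {μ : ℝ | ∃ f : (Fin (m + 2) → V) → ℝ, X.IsForm (m + 2) f ∧ f ≠ 0 ∧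
              (∃ g, X.IsForm (m + 3) g ∧ X.bdry g = f) ∧ X.lapUp f = μ • f}) ^ nn := by
  intro σ₀ h₀ nn
  have hdeg : ∀ σ : Fin (m + 1 + 1) → V, X.IsCellT σ → X.degT σ ≠ 0 :=
    fun σ hσ => degT_ne_zero huni hσ
  have hcast : p * ((m + 1 : ℕ) : ℝ) + 1 = p * ((m : ℝ) + 1) + 1 := by push_cast; rfl
  constructor
  · obtain ⟨h, hh, hle⟩ := exists_orthogonal_normW_nexp_le hdeg hp₁ hp₂ h₀
      (LinearMap.ker (X.bdryL m)) (fun f _ => Subtype.ext (f.2.cobdry.bdry_bdry)) nn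
    refine sInf_normW_le (isExactForm_of_orthogonal h fun u hu =>
      hh u (Subtype.ext hu)) (hle.trans_eq ?_)
    rw [hcast]
    congr 5
    ext μ
    constructor
    · rintro ⟨f, hf, hf0, hμ⟩
      exact ⟨f, f.2, fun h => hf0 (Subtype.ext h), congrArg Subtype.val hf,
        (coe_lapL hdeg f).symm.trans (congrArg Subtype.val hμ)⟩
    · rintro ⟨f, hf, hf0, hb, hμ⟩
      exact ⟨⟨f, hf⟩, Subtype.ext hb, fun h => hf0 (congrArg Subtype.val h),
        Subtype.ext ((coe_lapL hdeg ⟨f, hf⟩).trans hμ)⟩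
  · obtain ⟨h, hh, hle⟩ := exists_orthogonal_normW_nexp_le hdeg hp₁ hp₂ h₀
      (LinearMap.range (X.bdryL (m + 1))) (fun f _ => ⟨X.cobdryL (m + 2) f, rfl⟩) nn
    refine sInf_normW_le (P := X.IsClosedForm m)
      ⟨h.2, fun g hg => hh _ ⟨⟨g, hg⟩, rfl⟩⟩ (hle.trans_eq ?_)
    rw [hcast]
    congr 5
    ext μ
    constructor
    · rintro ⟨_, ⟨g, rfl⟩, hf0, hμ⟩
      exact ⟨X.bdry g, g.2.bdry, fun h => hf0 (Subtype.ext h), ⟨g, g.2, rfl⟩,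
        (coe_lapL hdeg (X.bdryL (m + 1) g)).symm.trans (congrArg Subtype.val hμ)⟩
    · rintro ⟨_, hf, hf0, ⟨g, hg, rfl⟩, hμ⟩
      exact ⟨X.bdryL (m + 1) ⟨g, hg⟩, ⟨_, rfl⟩, fun h => hf0 (congrArg Subtype.val h),
        Subtype.ext ((coe_lapL hdeg (X.bdryL (m + 1) ⟨g, hg⟩)).trans hμ)⟩

end
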